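/- Define ∇'(Σᵢ Aᵢ⊗aᵢ) := Σ_{i,k} τ(Xₖ)Aᵢ ⊗ ∂^k(aᵢ) and the first Chern class c₁(Σᵢ Aᵢ⊗aᵢ) := Σᵢ Aᵢ ⊗ Σ_{l,j} c^j_{lj} ∂^l(aᵢ). Then for every 𝒜 in the classical family algebra C_τ(𝔤), one has ∇(𝒜) − ∇'(𝒜) = −c₁(𝒜). -/

import Mathlib

open TensorProduct MvPolynomial

noncomputable section

/-- The bilinear map `(a, b) ↦ u * D₁ a * D₂ b` on polynomials. -/
def bil {n : ℕ} (u : MvPolynomial (Fin n) ℂ)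
    (D₁ D₂ : MvPolynomial (Fin n) ℂ →ₗ[ℂ] MvPolynomial (Fin n) ℂ) :
    MvPolynomial (Fin n) ℂ →ₗ[ℂ] MvPolynomial (Fin n) ℂ →ₗ[ℂ] MvPolynomial (Fin n) ℂ :=
  (((LinearMap.mul ℂ (MvPolynomial (Fin n) ℂ)).comp
      ((LinearMap.mulLeft ℂ u).comp D₁)).compl₂ D₂)

/-- The Poisson bracket `{a,b} = Σ c^k_{ij} X_k (∂^i a)(∂^j b)` on `S(𝔤)`. -/
def Pb {n : ℕ} (c : Fin n → Fin n → Fin n → ℂ) :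
    MvPolynomial (Fin n) ℂ →ₗ[ℂ] MvPolynomial (Fin n) ℂ →ₗ[ℂ] MvPolynomial (Fin n) ℂ :=
  ∑ i, ∑ j, ∑ k, c k i j •
    bil (X k) (pderiv i).toLinearMap (pderiv j).toLinearMap

/-- `A ↦ [f, A]` on `End V`. -/
def adE {V : Type*} [AddCommGroup V] [Module ℂ V] (f : Module.End ℂ V) :
    Module.End ℂ V →ₗ[ℂ] Module.End ℂ V :=
  LinearMap.mulLeft ℂ f - LinearMap.mulRight ℂ f

/-- The diagonal `𝔤`-action of the basis vector `X_l` on `End V ⊗ S(𝔤)`. -/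
def Dact {n : ℕ} (c : Fin n → Fin n → Fin n → ℂ) {V : Type*} [AddCommGroup V] [Module ℂ V]
    (τ : Fin n → Module.End ℂ V) (l : Fin n) :
    (Module.End ℂ V ⊗[ℂ] MvPolynomial (Fin n) ℂ) →ₗ[ℂ]
      (Module.End ℂ V ⊗[ℂ] MvPolynomial (Fin n) ℂ) :=
  LinearMap.rTensor _ (adE (τ l)) + LinearMap.lTensor _ (Pb c (X l))

/-- The map `∇ : A ⊗ a ↦ Σₖ A·τ(Xₖ) ⊗ ∂^k(a)` on `End V ⊗ S(𝔤)`. -/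
def nabla {n : ℕ} {V : Type*} [AddCommGroup V] [Module ℂ V]
    (τ : Fin n → Module.End ℂ V) :
    (Module.End ℂ V ⊗[ℂ] MvPolynomial (Fin n) ℂ) →ₗ[ℂ]
      (Module.End ℂ V ⊗[ℂ] MvPolynomial (Fin n) ℂ) :=
  ∑ k, (LinearMap.mulRight ℂ ((τ k) ⊗ₜ[ℂ] (1 : MvPolynomial (Fin n) ℂ))).comp
    (LinearMap.lTensor (Module.End ℂ V) (pderiv k).toLinearMap)

/-- The map `∇' : A ⊗ a ↦ Σₖ τ(Xₖ)·A ⊗ ∂^k(a)` on `End V ⊗ S(𝔤)`. -/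
def nabla' {n : ℕ} {V : Type*} [AddCommGroup V] [Module ℂ V]
    (τ : Fin n → Module.End ℂ V) :
    (Module.End ℂ V ⊗[ℂ] MvPolynomial (Fin n) ℂ) →ₗ[ℂ]
      (Module.End ℂ V ⊗[ℂ] MvPolynomial (Fin n) ℂ) :=
  ∑ k, (LinearMap.mulLeft ℂ ((τ k) ⊗ₜ[ℂ] (1 : MvPolynomial (Fin n) ℂ))).comp
    (LinearMap.lTensor (Module.End ℂ V) (pderiv k).toLinearMap)

/-- The first Chern class `c₁ : A ⊗ a ↦ A ⊗ Σ_{l,j} c^j_{lj} ∂^l(a)`. -/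
def chern1 {n : ℕ} (c : Fin n → Fin n → Fin n → ℂ) {V : Type*} [AddCommGroup V]
    [Module ℂ V] :
    (Module.End ℂ V ⊗[ℂ] MvPolynomial (Fin n) ℂ) →ₗ[ℂ]
      (Module.End ℂ V ⊗[ℂ] MvPolynomial (Fin n) ℂ) :=
  LinearMap.lTensor (Module.End ℂ V) (∑ l, ∑ j, c j l j • (pderiv l).toLinearMap)

theorem pderiv_pderiv_comm {n : ℕ} (i j : Fin n) (a : MvPolynomial (Fin n) ℂ) :
    pderiv i (pderiv j a) = pderiv j (pderiv i a) := by
  induction a using MvPolynomial.induction_on with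
  | C r => simp
  | add p q hp hq => simp only [map_add, hp, hq]
  | mul_X p k hp =>
    have hX (i j : Fin n) : pderiv i (pderiv j (X k : MvPolynomial (Fin n) ℂ)) = 0 := by
      by_cases h : k = j
      · simp [h]
      · simp [pderiv_X_of_ne h]
    simp only [pderiv_mul, map_add, hX, hp]
    ring

theorem Pb_X {n : ℕ} (c : Fin n → Fin n → Fin n → ℂ) (l : Fin n)
    (a : MvPolynomial (Fin n) ℂ) :
    Pb c (X l) a = ∑ j, ∑ k, c k l j • (X k * pderiv j a) := by
  simp only [Pb, bil, LinearMap.sum_apply, LinearMap.smul_apply, LinearMap.compl₂_apply,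
    LinearMap.comp_apply, LinearMap.mulLeft_apply, LinearMap.mul_apply', Derivation.coeFn_coe]
  rw [Finset.sum_eq_single l]
  · simp
  · intro i _ hi
    simp [pderiv_X_of_ne hi.symm]
  · simp

/-- A skew family contracted with the symmetric second derivatives vanishes. -/
theorem sum_skew_pderiv_pderiv {n : ℕ} (c : Fin n → Fin n → Fin n → ℂ)
    (hskew : ∀ k i j, c k i j = - c k j i) (a : MvPolynomial (Fin n) ℂ) :
    ∑ l, ∑ j, ∑ k, c k l j • (X k * pderiv l (pderiv j a)) = 0 := by
  refine self_eq_neg.mp ?_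
  conv_lhs => rw [Finset.sum_comm]
  simp only [← Finset.sum_neg_distrib]
  refine Finset.sum_congr rfl fun l _ => Finset.sum_congr rfl fun j _ =>
    Finset.sum_congr rfl fun k _ => ?_
  rw [hskew k j l, neg_smul, pderiv_pderiv_comm]

/-- The divergence of the Hamiltonian vector fields of the coordinates is the trace form. -/
theorem sum_pderiv_Pb_X {n : ℕ} (c : Fin n → Fin n → Fin n → ℂ)
    (hskew : ∀ k i j, c k i j = - c k j i) (a : MvPolynomial (Fin n) ℂ) :
    ∑ l, pderiv l (Pb c (X l) a) = - ∑ l, ∑ j, c j l j • pderiv l a := by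
  have h (l : Fin n) : pderiv l (Pb c (X l) a) =
      ∑ j, c l l j • pderiv j a + ∑ j, ∑ k, c k l j • (X k * pderiv l (pderiv j a)) := by
    simp only [Pb_X, map_sum, Derivation.map_smul, pderiv_mul, smul_add, Finset.sum_add_distrib]
    congr 1
    refine Finset.sum_congr rfl fun j _ => ?_
    rw [Finset.sum_eq_single l]
    · simp
    · intro k _ hk
      simp [pderiv_X_of_ne hk]
    · simp
  simp only [h, Finset.sum_add_distrib, sum_skew_pderiv_pderiv c hskew, add_zero]
  rw [Finset.sum_comm]
  simp only [← Finset.sum_neg_distrib, ← neg_smul, ← hskew]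

/-- Contracting the diagonal action with the partial derivatives measures the failure of
`∇ - ∇' = -c₁` on all of `End V ⊗ S(𝔤)`. -/
theorem nabla_sub_nabla'_add_chern1 {n : ℕ} (c : Fin n → Fin n → Fin n → ℂ)
    {V : Type*} [AddCommGroup V] [Module ℂ V] (τ : Fin n → Module.End ℂ V)
    (hskew : ∀ k i j, c k i j = - c k j i)
    (B : Module.End ℂ V ⊗[ℂ] MvPolynomial (Fin n) ℂ) :
    nabla τ B - nabla' τ B + chern1 c B =
      - ∑ l, LinearMap.lTensor (Module.End ℂ V) (pderiv l).toLinearMap (Dact c τ l B) := by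
  induction B with
  | zero => simp
  | add x y hx hy =>
    simp only [map_add, Finset.sum_add_distrib, neg_add, ← hx, ← hy]
    abel
  | tmul A a =>
    have h := congrArg (fun p => A ⊗ₜ[ℂ] p) (sum_pderiv_Pb_X c hskew a)
    simp only [tmul_sum, tmul_neg] at h
    simp only [nabla, nabla', chern1, Dact, adE, LinearMap.sum_apply, LinearMap.comp_apply,
      LinearMap.add_apply, LinearMap.sub_apply, LinearMap.smul_apply, LinearMap.lTensor_tmul,
      LinearMap.rTensor_tmul, LinearMap.mulLeft_apply, LinearMap.mulRight_apply,
      Derivation.coeFn_coe, Algebra.TensorProduct.tmul_mul_tmul, mul_one, one_mul, map_add, map_sub,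
      Finset.sum_add_distrib, sub_tmul, Finset.sum_sub_distrib, tmul_sum, h]
    abel

/-- on the classical family algebra, `∇ − ∇' = −c₁`. -/
theorem stmt18 {n : ℕ} (c : Fin n → Fin n → Fin n → ℂ)
    {V : Type*} [AddCommGroup V] [Module ℂ V] (τ : Fin n → Module.End ℂ V)
    (hskew : ∀ k i j, c k i j = - c k j i)
    (hjac : ∀ i j l m, (∑ k, (c k i j * c m k l + c k j l * c m k i + c k l i * c m k j)) = 0)
    (hτ : ∀ i j, τ i * τ j - τ j * τ i = ∑ k, c k i j • τ k)
    (𝒜 : Module.End ℂ V ⊗[ℂ] MvPolynomial (Fin n) ℂ)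
    (h𝒜 : ∀ l, Dact c τ l 𝒜 = 0) :
    nabla τ 𝒜 - nabla' τ 𝒜 = - chern1 c 𝒜 := by
  rw [eq_neg_iff_add_eq_zero, nabla_sub_nabla'_add_chern1 c τ hskew]
  simp [h𝒜]

end
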